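/- arXiv:1811.12702 — 2 statements merged into one kernel-verified Lean document; each statement's English description precedes it below -/
import Mathlib

section
/- Assume hypothesis (H0) and let W be a p₀-OMRF with p₀ ≥ 0. Then for every σ > 0 there exists a continuous, increasing map γ_σ : (0,σ] → (0,∞) such that H(x,p₀,p) < −γ_σ(W(x)) for every x ∈ W⁻¹((0,σ]) and every p ∈ D*W(x). -/
open Filter Topology Metric MeasureTheory Bornology
open scoped RealInnerProductSpace ENNReal NNReal

noncomputable section

abbrev Euc (n : ℕ) : Type := EuclideanSpace ℝ (Fin n)

/-- Distance to the target set. -/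
def dC {n : ℕ} (C : Set (Euc n)) (y : Euc n) : ℝ := Metric.infDist y C

/-- The Hamiltonian `H(x, p₀, p) = inf_{u ∈ U} (⟪p, f(x,u)⟫ + p₀ l(x,u))`. -/
def Ham {n m : ℕ} (U : Set (Euc m)) (f : Euc n → Euc m → Euc n) (l : Euc n → Euc m → ℝ)
    (p0 : ℝ) (x p : Euc n) : ℝ :=
  sInf ((fun u => ⟪p, f x u⟫ + p0 * l x u) '' U)

/-- The Hamiltonian truncated to controls of norm at most `N`. -/
def HamN {n m : ℕ} (U : Set (Euc m)) (f : Euc n → Euc m → Euc n) (l : Euc n → Euc m → ℝ)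
    (N : ℝ) (p0 : ℝ) (x p : Euc n) : ℝ :=
  sInf ((fun u => ⟪p, f x u⟫ + p0 * l x u) '' (U ∩ Metric.closedBall 0 N))

/-- Set of limiting gradients `D*W(x)`. -/
def limitingGradients {n : ℕ} (W : Euc n → ℝ) (x : Euc n) : Set (Euc n) :=
  {w | ∃ xk : ℕ → Euc n, (∀ k, DifferentiableAt ℝ W (xk k) ∧ xk k ≠ x) ∧
    Tendsto xk atTop (𝓝 x) ∧ Tendsto (fun k => gradient W (xk k)) atTop (𝓝 w)}

/-- Proximal subdifferential `∂_P W(x)`. -/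
def proxSubdiff {n : ℕ} (W : Euc n → ℝ) (x : Euc n) : Set (Euc n) :=
  {p | ∃ σ > (0:ℝ), ∃ η > (0:ℝ), ∀ y, ‖y - x‖ ≤ η →
    ⟪p, y - x⟫ ≤ W y - W x + σ * ‖y - x‖ ^ 2}

/-- Limiting subdifferential `∂_L W(x)`. -/
def limitingSubdiff {n : ℕ} (W : Euc n → ℝ) (x : Euc n) : Set (Euc n) :=
  {p | ∃ (xk : ℕ → Euc n) (pk : ℕ → Euc n), (∀ k, pk k ∈ proxSubdiff W (xk k)) ∧
    Tendsto xk atTop (𝓝 x) ∧ Tendsto pk atTop (𝓝 p)}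

/-- `W` is positive definite on `ℝⁿ ∖ C`. -/
def PosDefOn {n : ℕ} (C : Set (Euc n)) (W : Euc n → ℝ) : Prop :=
  (∀ x, x ∉ C → 0 < W x) ∧ ∀ x ∈ frontier C, W x = 0

/-- `W` is proper on `ℝⁿ ∖ C`: preimages (within the closure of the complement of the
target) of compact subsets of `[0,∞)` are compact. -/
def ProperOn {n : ℕ} (C : Set (Euc n)) (W : Euc n → ℝ) : Prop :=
  ∀ Kc : Set ℝ, IsCompact Kc → Kc ⊆ Set.Ici 0 → IsCompact (closure Cᶜ ∩ W ⁻¹' Kc)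

/-- `W` is locally semiconcave on `ℝⁿ ∖ C`. -/
def LocSemiconcaveOn {n : ℕ} (C : Set (Euc n)) (W : Euc n → ℝ) : Prop :=
  ∀ S : Set (Euc n), IsCompact S → S ⊆ Cᶜ → ∃ ρ > (0:ℝ),
    ∀ x y : Euc n, segment ℝ x y ⊆ S →
      W x + W y - 2 * W (midpoint ℝ x y) ≤ ρ * ‖x - y‖ ^ 2

/-- `W` is locally Lipschitz continuous on the set `s`. -/
def LocLipschitzOn {n : ℕ} (s : Set (Euc n)) (W : Euc n → ℝ) : Prop :=
  ∀ x ∈ s, ∃ (K : ℝ≥0) (t : Set (Euc n)), t ∈ nhdsWithin x s ∧ LipschitzOnWith K W t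

/-- `γ : (0,∞) → (0,∞)` is a continuous, strictly increasing rate function. -/
def RateFun (γ : ℝ → ℝ) : Prop :=
  ContinuousOn γ (Set.Ioi 0) ∧ StrictMonoOn γ (Set.Ioi 0) ∧ ∀ r, 0 < r → 0 < γ r

/-- `W` is a `p₀`-Minimum Restraint Function with rate `γ`. -/
def IsMRF {n m : ℕ} (C : Set (Euc n)) (U : Set (Euc m)) (f : Euc n → Euc m → Euc n)
    (l : Euc n → Euc m → ℝ) (p0 : ℝ) (W : Euc n → ℝ) (γ : ℝ → ℝ) : Prop :=
  ContinuousOn W (closure Cᶜ) ∧ (∀ x ∈ closure Cᶜ, 0 ≤ W x) ∧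
  LocSemiconcaveOn C W ∧ PosDefOn C W ∧ ProperOn C W ∧ RateFun γ ∧
  ∀ x, x ∉ C → ∀ p ∈ limitingGradients W x, Ham U f l p0 x p ≤ -γ (W x)

/-- `W` is a `p₀`-OMRF (original Minimum Restraint Function of Motta-Rampazzo). -/
def IsOMRF {n m : ℕ} (C : Set (Euc n)) (U : Set (Euc m)) (f : Euc n → Euc m → Euc n)
    (l : Euc n → Euc m → ℝ) (p0 : ℝ) (W : Euc n → ℝ) : Prop :=
  ContinuousOn W (closure Cᶜ) ∧ (∀ x ∈ closure Cᶜ, 0 ≤ W x) ∧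
  LocSemiconcaveOn C W ∧ PosDefOn C W ∧ ProperOn C W ∧
  ∀ x, x ∉ C → ∀ p ∈ limitingGradients W x, Ham U f l p0 x p < 0

/-- Hypothesis (H0). -/
def HypH0 {n m : ℕ} (C : Set (Euc n)) (U : Set (Euc m)) (f : Euc n → Euc m → Euc n)
    (l : Euc n → Euc m → ℝ) : Prop :=
  IsClosed C ∧ IsCompact (frontier C) ∧ IsClosed U ∧
  (∀ x u, u ∈ U → 0 ≤ l x u) ∧
  (∀ Kc : Set (Euc n), IsCompact Kc → Kc ⊆ Cᶜ →
    UniformContinuousOn (fun q : Euc n × Euc m => f q.1 q.2) (Kc ×ˢ U) ∧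
    UniformContinuousOn (fun q : Euc n × Euc m => l q.1 q.2) (Kc ×ˢ U)) ∧
  (∀ R : ℝ, 0 < R → ∃ M : ℝ, 0 < M ∧ ∀ x u, dC C x ≤ R → x ∉ C → u ∈ U →
    ‖f x u‖ ≤ M ∧ l x u ≤ M)

/-- Hypothesis (H1). -/
def HypH1 {n m : ℕ} (C : Set (Euc n)) (U : Set (Euc m)) (f : Euc n → Euc m → Euc n)
    (l : Euc n → Euc m → ℝ) : Prop :=
  IsClosed C ∧ IsCompact (frontier C) ∧ IsClosed U ∧
  (∀ x u, u ∈ U → 0 ≤ l x u) ∧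
  ContinuousOn (fun q : Euc n × Euc m => f q.1 q.2) (closure Cᶜ ×ˢ U) ∧
  ContinuousOn (fun q : Euc n × Euc m => l q.1 q.2) (closure Cᶜ ×ˢ U) ∧
  (∀ Kc : Set (Euc n), IsCompact Kc → Kc ⊆ closure Cᶜ →
    ∃ Mf Ml Lf Ll : ℝ, 0 < Mf ∧ 0 < Ml ∧ 0 < Lf ∧ 0 < Ll ∧
      (∀ x ∈ Kc, ∀ u ∈ U, ‖f x u‖ ≤ Mf ∧ l x u ≤ Ml) ∧
      (∀ x₁ ∈ Kc, ∀ x₂ ∈ Kc, ∀ u ∈ U,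
        ‖f x₁ u - f x₂ u‖ ≤ Lf * ‖x₁ - x₂‖ ∧ |l x₁ u - l x₂ u| ≤ Ll * ‖x₁ - x₂‖))

/-- A partition of `[0,∞)`. -/
structure TimePartition where
  t : ℕ → ℝ
  zero : t 0 = 0
  mono : StrictMono t
  unbounded : Tendsto t atTop atTop

/-- A class-`KL` comparison function. -/
structure IsKL (β : ℝ → ℝ → ℝ) : Prop where
  nonneg : ∀ r t, 0 ≤ r → 0 ≤ t → 0 ≤ β r t
  cont : ∀ t, 0 ≤ t → ContinuousOn (fun r => β r t) (Set.Ici 0)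
  strictMono : ∀ t, 0 ≤ t → StrictMonoOn (fun r => β r t) (Set.Ici 0)
  zero : ∀ t, 0 ≤ t → β 0 t = 0
  anti : ∀ r, 0 ≤ r → AntitoneOn (fun t => β r t) (Set.Ici 0)
  tendsto : ∀ r, 0 ≤ r → Tendsto (fun t => β r t) atTop (𝓝 0)

/-- `(x,u)` is a `π`-sampling trajectory-control pair from `z` associated with the
feedback `K`, with exit time `T`; trajectories reaching the target at a finite exit
time are extended to `[0,∞)` by their limit value. -/
structure IsSamplingSol {n m : ℕ} (C : Set (Euc n)) (U : Set (Euc m))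
    (f : Euc n → Euc m → Euc n) (K : Euc n → Euc m) (π : TimePartition) (z : Euc n)
    (x : ℝ → Euc n) (u : ℝ → Euc m) (T : ℝ≥0∞) : Prop where
  pos : 0 < T
  init : x 0 = z
  cont : ContinuousOn x (Set.Ici 0)
  ctrl : ∀ j : ℕ, ∀ t ∈ Set.Ico (π.t j) (π.t (j+1)), u t = K (x (π.t j))
  outside : ∀ t : ℝ, 0 ≤ t → ENNReal.ofReal t < T → x t ∉ C
  deriv : ∀ t : ℝ, 0 < t → ENNReal.ofReal t < T → (∀ j, t ≠ π.t j) →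
    HasDerivAt x (f (x t) (u t)) t
  exit : ∀ tr : ℝ, 0 ≤ tr → T = ENNReal.ofReal tr →
    dC C (x tr) = 0 ∧ ∀ s, tr ≤ s → x s = x tr

/-- The time `T̄ᵣ` after which the trajectory remains in the `r`-neighbourhood
of the target. -/
def Tbar {n : ℕ} (C : Set (Euc n)) (x : ℝ → Euc n) (r : ℝ) : ℝ :=
  sInf {t : ℝ | 0 < t ∧ ∀ τ, t ≤ τ → dC C (x τ) ≤ r}

/-- `K` sample stabilizes the system to `C` with `(q,W)`-regulated cost, for initial
points in `Z`. -/
def SampleStabOn {n m : ℕ} (C : Set (Euc n)) (U : Set (Euc m))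
    (f : Euc n → Euc m → Euc n) (l : Euc n → Euc m → ℝ) (K : Euc n → Euc m)
    (Z : Set (Euc n)) (q : ℝ) (W : Euc n → ℝ) : Prop :=
  ∃ β : ℝ → ℝ → ℝ, IsKL β ∧
    ∀ r R : ℝ, 0 < r → r < R → ∃ δ > (0:ℝ),
      ∀ π : TimePartition, (∀ j, π.t (j+1) - π.t j ≤ δ) →
      ∀ z ∈ Z, dC C z ≤ R →
      ∀ x u T, IsSamplingSol C U f K π z x u T →
        (∀ t, 0 ≤ t → dC C (x t) ≤ max (β R t) r) ∧
        (∫ τ in (0:ℝ)..(Tbar C x r), l (x τ) (u τ)) ≤ W z / q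

/-- `X` is an Euler trajectory of the system from `z` associated with `K`. -/
def IsEulerTraj {n m : ℕ} (C : Set (Euc n)) (U : Set (Euc m))
    (f : Euc n → Euc m → Euc n) (K : Euc n → Euc m) (z : Euc n) (X : ℝ → Euc n) : Prop :=
  ∃ (π : ℕ → TimePartition) (x : ℕ → ℝ → Euc n) (u : ℕ → ℝ → Euc m)
    (T : ℕ → ℝ≥0∞) (δ : ℕ → ℝ),
    Tendsto δ atTop (𝓝 0) ∧ (∀ i j, (π i).t (j+1) - (π i).t j ≤ δ i) ∧
    (∀ i, IsSamplingSol C U f K (π i) z (x i) (u i) (T i)) ∧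
    TendstoLocallyUniformlyOn x X atTop (Set.Ici 0)

/-- `(X, X⁰)` is an Euler trajectory-cost pair from `z` associated with `K`. -/
def IsEulerPair {n m : ℕ} (C : Set (Euc n)) (U : Set (Euc m))
    (f : Euc n → Euc m → Euc n) (l : Euc n → Euc m → ℝ) (K : Euc n → Euc m)
    (z : Euc n) (X : ℝ → Euc n) (X0 : ℝ → ℝ) : Prop :=
  ∃ (π : ℕ → TimePartition) (x : ℕ → ℝ → Euc n) (u : ℕ → ℝ → Euc m)
    (T : ℕ → ℝ≥0∞) (δ : ℕ → ℝ),
    Tendsto δ atTop (𝓝 0) ∧ (∀ i j, (π i).t (j+1) - (π i).t j ≤ δ i) ∧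
    (∀ i, IsSamplingSol C U f K (π i) z (x i) (u i) (T i)) ∧
    TendstoLocallyUniformlyOn x X atTop (Set.Ici 0) ∧
    TendstoLocallyUniformlyOn (fun i s => ∫ τ in (0:ℝ)..s, l (x i τ) (u i τ)) X0
      atTop (Set.Ici 0)

/-- The filter of approach to `T` from the left (`atTop` when `T = ∞`). -/
def leftFilter (T : ℝ≥0∞) : Filter ℝ :=
  if T = ⊤ then Filter.atTop else nhdsWithin T.toReal (Set.Iio T.toReal)

/-- The exit time `T_X` of a (Euler) trajectory `X`. -/
def exitTimeInf {n : ℕ} (C : Set (Euc n)) (X : ℝ → Euc n) : ℝ≥0∞ :=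
  sInf {τ : ℝ≥0∞ | 0 < τ ∧ (∀ t : ℝ, 0 ≤ t → ENNReal.ofReal t < τ → X t ∉ C) ∧
    Tendsto (fun t => dC C (X t)) (leftFilter τ) (𝓝 0)}

/-- `K` Euler stabilizes the system to `C` with `(q,W)`-regulated cost, for initial
points in `Z`. -/
def EulerStabOn {n m : ℕ} (C : Set (Euc n)) (U : Set (Euc m))
    (f : Euc n → Euc m → Euc n) (l : Euc n → Euc m → ℝ) (K : Euc n → Euc m)
    (Z : Set (Euc n)) (q : ℝ) (W : Euc n → ℝ) : Prop :=
  ∃ β : ℝ → ℝ → ℝ, IsKL β ∧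
    ∀ z ∈ Z,
      (∀ X, IsEulerTraj C U f K z X → ∀ t, 0 ≤ t → dC C (X t) ≤ β (dC C z) t) ∧
      (∀ X X0, IsEulerPair C U f l K z X X0 →
        ∀ t, 0 ≤ t → ENNReal.ofReal t < exitTimeInf C X → X0 t ≤ W z / q)

/-- A locally bounded feedback taking values in the control set. -/
def IsFeedback {n m : ℕ} (C : Set (Euc n)) (U : Set (Euc m)) (K : Euc n → Euc m) : Prop :=
  (∀ x, x ∉ C → K x ∈ U) ∧
  ∀ x, x ∉ C → ∃ V ∈ 𝓝 x, Bornology.IsBounded (K '' (V \ C))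

/-- `K` is a `W`-feedback: for the selection `psel x ∈ D*W(x)`, `K x` minimizes
`u ↦ ⟪psel x, f(x,u)⟫ + p₀ l(x,u)` over `U ∩ B(0, N(W x))`. -/
def IsWFeedback {n m : ℕ} (C : Set (Euc n)) (U : Set (Euc m))
    (f : Euc n → Euc m → Euc n) (l : Euc n → Euc m → ℝ) (p0 : ℝ) (W : Euc n → ℝ)
    (N : ℝ → ℝ) (psel : Euc n → Euc n) (K : Euc n → Euc m) : Prop :=
  ∀ x, x ∉ C →
    K x ∈ U ∩ Metric.closedBall 0 (N (W x)) ∧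
    ∀ v ∈ U ∩ Metric.closedBall 0 (N (W x)),
      ⟪psel x, f x (K x)⟫ + p0 * l x (K x) ≤ ⟪psel x, f x v⟫ + p0 * l x v

/-- `(x,u)` is an admissible trajectory-control pair from `z` with exit time `T`. -/
structure IsAdmissiblePair {n m : ℕ} (C : Set (Euc n)) (U : Set (Euc m))
    (f : Euc n → Euc m → Euc n) (z : Euc n) (x : ℝ → Euc n) (u : ℝ → Euc m)
    (T : ℝ≥0∞) : Prop where
  pos : 0 < T
  init : x 0 = z
  outside : ∀ t : ℝ, 0 ≤ t → ENNReal.ofReal t < T → x t ∉ C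
  ctrlmem : ∀ t : ℝ, 0 ≤ t → ENNReal.ofReal t < T → u t ∈ U
  meas : AEStronglyMeasurable u volume
  locbdd : ∀ b : ℝ, 0 ≤ b → ENNReal.ofReal b < T →
    ∃ M : ℝ, ∀ᵐ s ∂volume, s ∈ Set.Icc (0:ℝ) b → ‖u s‖ ≤ M
  sol : ∀ t : ℝ, 0 ≤ t → ENNReal.ofReal t < T →
    x t = z + ∫ s in (0:ℝ)..t, f (x s) (u s)

end

lemma rate_aux (A : Set (ℝ × ℝ)) (hc : ∀ r : ℝ, 0 < r → ∃ c > (0:ℝ), ∀ a ∈ A, r ≤ a.1 → c ≤ a.2)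
    (hpos : ∀ a ∈ A, 0 < a.2) :
    ∃ γ : ℝ → ℝ, Continuous γ ∧ Monotone γ ∧ (∀ r, 0 < r → 0 < γ r) ∧
      ∀ a ∈ A, 0 < a.1 → γ a.1 < a.2 := by
  by_cases hA : A.Nonempty
  swap
  · rw [Set.not_nonempty_iff_eq_empty] at hA
    subst hA
    exact ⟨fun _ => 1, continuous_const, monotone_const, fun _ _ => one_pos, by simp⟩
  have : Nonempty A := hA.to_subtype
  let F : ℝ → A → ℝ := fun r a => a.1.2 + max (r - a.1.1) 0
  have hF0 : ∀ r a, 0 ≤ F r a := fun r a =>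
    add_nonneg (hpos a.1 a.2).le (le_max_right _ _)
  have hbdd : ∀ r, BddBelow (Set.range (F r)) := fun r =>
    ⟨0, by rintro _ ⟨a, rfl⟩; exact hF0 r a⟩
  let g : ℝ → ℝ := fun r => ⨅ a, F r a
  have hmono : Monotone g := by
    intro r s hrs
    refine ciInf_mono (hbdd r) fun a => ?_
    have : max (r - a.1.1) 0 ≤ max (s - a.1.1) 0 := max_le_max (by linarith) le_rfl
    simp only [F]; linarith
  have hlip : ∀ r s, r ≤ s → g s ≤ g r + (s - r) := by
    intro r s hrs
    have : g s - (s - r) ≤ g r := by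
      refine le_ciInf fun a => ?_
      have h1 : g s ≤ F s a := ciInf_le (hbdd s) a
      have : max (s - a.1.1) 0 ≤ max (r - a.1.1) 0 + (s - r) := by
        apply max_le
        · linarith [le_max_left (r - a.1.1) 0]
        · linarith [le_max_right (r - a.1.1) 0]
      simp only [F] at h1 ⊢; linarith
    linarith
  have hgl : LipschitzWith 1 g := by
    apply LipschitzWith.of_dist_le_mul
    intro r s
    rw [Real.dist_eq, Real.dist_eq]
    rcases le_total r s with h | h
    · rw [abs_of_nonpos (by linarith [hmono h]), abs_of_nonpos (by linarith)]
      have := hlip r s h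
      push_cast; linarith
    · rw [abs_of_nonneg (by linarith [hmono h]), abs_of_nonneg (by linarith)]
      have := hlip s r h
      push_cast; linarith
  have hgpos : ∀ r, 0 < r → 0 < g r := by
    intro r hr
    obtain ⟨c, hc0, hc⟩ := hc (r / 2) (by linarith)
    refine lt_of_lt_of_le (lt_min hc0 (half_pos hr)) (le_ciInf fun a => ?_)
    have hp := hpos a.1 a.2
    rcases le_total (r / 2) a.1.1 with h | h
    · have := hc a.1 a.2 h
      have h2 := le_max_right (r - a.1.1) 0
      refine (min_le_left _ _).trans ?_
      simp only [F]; linarith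
    · have h2 := le_max_left (r - a.1.1) 0
      refine (min_le_right _ _).trans ?_
      simp only [F]; linarith
  refine ⟨fun r => g r / 2, hgl.continuous.div_const 2, fun r s h => ?_, fun r hr => ?_, ?_⟩
  · have := hmono h
    simp only; linarith
  · have := hgpos r hr
    simp only; linarith
  · intro a ha h0
    have h1 : g a.1 ≤ F a.1 ⟨a, ha⟩ := ciInf_le (hbdd a.1) ⟨a, ha⟩
    have h2 := hgpos a.1 h0
    simp only [F, sub_self, max_self, add_zero] at h1
    simp only; linarith

lemma semiconcave_grad {n : ℕ} {W : Euc n → ℝ} {S : Set (Euc n)} {ρ : ℝ}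
    (hρ : ∀ x y : Euc n, segment ℝ x y ⊆ S →
      W x + W y - 2 * W (midpoint ℝ x y) ≤ ρ * ‖x - y‖ ^ 2)
    (hS : Convex ℝ S) (y h : Euc n) (hy : y ∈ S) (hyh : y + h ∈ S) (hρ0 : 0 < ρ)
    (hd : DifferentiableAt ℝ W y) :
    W (y + h) - W y ≤ ⟪gradient W y, h⟫ + 2 * ρ * ‖h‖ ^ 2 := by
  have key : ∀ k : ℕ, W (y + h) - W y ≤
      (2:ℝ) ^ k • (W (y + ((2:ℝ) ^ k)⁻¹ • h) - W y) + 2 * ρ * ‖h‖ ^ 2 * (1 - ((2:ℝ) ^ k)⁻¹) := by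
    intro k
    induction k with
    | zero => simp
    | succ k ih =>
      have hmem : y + ((2:ℝ) ^ k)⁻¹ • h ∈ S := by
        refine hS.add_smul_mem hy hyh ⟨by positivity, ?_⟩
        exact inv_le_one_of_one_le₀ (one_le_pow₀ (by norm_num))
      have h1 := hρ y (y + ((2:ℝ) ^ k)⁻¹ • h) (hS.segment_subset hy hmem)
      have hmid : midpoint ℝ y (y + ((2:ℝ) ^ k)⁻¹ • h) = y + ((2:ℝ) ^ (k+1))⁻¹ • h := by
        rw [midpoint_eq_smul_add, pow_succ, mul_inv, invOf_eq_inv]; module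
      rw [hmid] at h1
      have hn : ‖y - (y + ((2:ℝ) ^ k)⁻¹ • h)‖ = ((2:ℝ) ^ k)⁻¹ * ‖h‖ := by
        rw [sub_add_cancel_left, norm_neg, norm_smul, Real.norm_of_nonneg (by positivity)]
      rw [hn] at h1
      have h2 : (0:ℝ) < 2 ^ k := by positivity
      refine ih.trans ?_
      have h3 := mul_le_mul_of_nonneg_left h1 h2.le
      have h4 : (2:ℝ) ^ k * (ρ * (((2:ℝ) ^ k)⁻¹ * ‖h‖) ^ 2) = ρ * ‖h‖ ^ 2 * ((2:ℝ) ^ k)⁻¹ := by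
        field_simp
      rw [h4] at h3
      have h5 : ((2:ℝ) ^ (k+1))⁻¹ = ((2:ℝ) ^ k)⁻¹ / 2 := by rw [pow_succ, mul_inv]; rfl
      have h6 : (2:ℝ) ^ (k+1) = 2 ^ k * 2 := pow_succ _ _
      simp only [smul_eq_mul]
      set w := W (y + ((2:ℝ) ^ (k+1))⁻¹ • h)
      rw [h5, h6]
      linarith
  have hg := hd.hasGradientAt.hasFDerivAt
  have ht : Tendsto (fun k : ℕ => (2:ℝ) ^ k) atTop atTop :=
    tendsto_pow_atTop_atTop_of_one_lt (by norm_num)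
  have hlim := hg.lim h (c := fun k : ℕ => (2:ℝ) ^ k)
    (tendsto_norm_atTop_atTop.comp ht)
  have hlim2 : Tendsto (fun k : ℕ => 2 * ρ * ‖h‖ ^ 2 * (1 - ((2:ℝ) ^ k)⁻¹)) atTop
      (𝓝 (2 * ρ * ‖h‖ ^ 2 * (1 - 0))) :=
    ((tendsto_inv_atTop_zero.comp ht).const_sub 1).const_mul _
  have := ge_of_tendsto' (hlim.add hlim2) key
  simpa using this

lemma grad_bound {n : ℕ} {C : Set (Euc n)} {W : Euc n → ℝ} (hC : IsClosed C)
    (hcont : ContinuousOn W (closure Cᶜ)) (hsc : LocSemiconcaveOn C W) {x : Euc n} (hx : x ∉ C) :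
    ∃ δ > (0:ℝ), ∃ M : ℝ, ∀ y ∈ ball x δ, DifferentiableAt ℝ W y → ‖gradient W y‖ ≤ M := by
  obtain ⟨ε, hε, hball⟩ := Metric.nhds_basis_closedBall.mem_iff.1 (hC.isOpen_compl.mem_nhds hx)
  obtain ⟨ρ, hρ0, hρ⟩ := hsc (closedBall x ε) (isCompact_closedBall x ε) hball
  obtain ⟨B, hB⟩ := (isCompact_closedBall x ε).exists_bound_of_continuousOn
    (hcont.mono (hball.trans subset_closure))
  refine ⟨ε / 2, by linarith, (2 * B + 2 * ρ * (ε / 2) ^ 2) / (ε / 2), fun y hy hd => ?_⟩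
  have hy' : dist y x < ε / 2 := hy
  have hyS : y ∈ closedBall x ε := by rw [mem_closedBall]; linarith
  rw [le_div_iff₀ (by linarith)]
  by_cases h0 : gradient W y = 0
  · have : 0 ≤ B := (norm_nonneg _).trans (hB y hyS)
    rw [h0, norm_zero, zero_mul]; positivity
  have hn : 0 < ‖gradient W y‖ := norm_pos_iff.2 h0
  set v := gradient W y with hv
  let h : Euc n := (-(ε / 2) / ‖v‖) • v
  have hnh : ‖h‖ = ε / 2 := by
    have h1 : ‖-(ε / 2) / ‖v‖‖ = (ε / 2) / ‖v‖ := by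
      rw [neg_div, norm_neg, Real.norm_of_nonneg (by positivity)]
    simp only [h]
    rw [norm_smul, h1, div_mul_cancel₀ _ hn.ne']
  have hyh : y + h ∈ closedBall x ε := by
    rw [mem_closedBall]
    calc dist (y + h) x ≤ dist (y + h) y + dist y x := dist_triangle _ _ _
      _ ≤ ε / 2 + ε / 2 := by
        rw [dist_self_add_left, hnh]; linarith
      _ = ε := by ring
  have := semiconcave_grad hρ (convex_closedBall x ε) y h hyS hyh hρ0 hd
  have hin : ⟪v, h⟫ = -(ε / 2) * ‖v‖ := by
    simp only [h, inner_smul_right, real_inner_self_eq_norm_sq]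
    field_simp
  rw [← hv, hin, hnh] at this
  have b1 := abs_le.1 (hB y hyS)
  have b2 := abs_le.1 (hB _ hyh)
  linarith [b1.1, b1.2, b2.1, b2.2]

lemma approx_grad {n : ℕ} {W : Euc n → ℝ} {x x' p : Euc n} (hp : p ∈ limitingGradients W x')
    {ε : ℝ} (hε : 0 < ε) :
    ∃ y, DifferentiableAt ℝ W y ∧ y ≠ x ∧ dist y x' < ε ∧ dist (gradient W y) p < ε := by
  obtain ⟨xk, h1, h2, h3⟩ := hp
  have e1 : ∀ᶠ k in atTop, dist (xk k) x' < ε := h2 (ball_mem_nhds _ hε)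
  have e2 : ∀ᶠ k in atTop, dist (gradient W (xk k)) p < ε := h3 (ball_mem_nhds _ hε)
  have e3 : ∀ᶠ k in atTop, xk k ≠ x := by
    by_cases h : x' = x
    · subst h; exact Eventually.of_forall fun k => (h1 k).2
    · exact h2.eventually_ne h
  obtain ⟨k, a, b, c⟩ := (e1.and (e2.and e3)).exists
  exact ⟨xk k, (h1 k).1, c, a, b⟩

lemma local_rate {n m : ℕ} (C : Set (Euc n)) (U : Set (Euc m))
    (f : Euc n → Euc m → Euc n) (l : Euc n → Euc m → ℝ)
    (p0 : ℝ) (W : Euc n → ℝ)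
    (hH0 : HypH0 C U f l) (hp0 : 0 ≤ p0) (hW : IsOMRF C U f l p0 W) {x : Euc n} (hx : x ∉ C) :
    ∃ c > (0:ℝ), ∀ᶠ x' in 𝓝 x, ∀ p ∈ limitingGradients W x', Ham U f l p0 x' p ≤ -c := by
  obtain ⟨hC, -, -, hl, huc, hbd⟩ := hH0
  obtain ⟨hcont, -, hsc, -, -, hneg⟩ := hW
  obtain ⟨δ, hδ, M, hM⟩ := grad_bound hC hcont hsc hx
  by_contra! hcon
  have hev : ∀ k : ℕ, ∃ x' p, x' ∉ C ∧ dist x' x < 1 / ((k:ℝ) + 1) ∧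
      p ∈ limitingGradients W x' ∧ -(1 / ((k:ℝ) + 1)) < Ham U f l p0 x' p := by
    intro k
    have hk : (0:ℝ) < 1 / ((k:ℝ) + 1) := Nat.one_div_pos_of_nat
    have := (hcon _ hk).and_eventually
      ((hC.isOpen_compl.eventually_mem hx).and (ball_mem_nhds x hk : ∀ᶠ y in 𝓝 x, _))
    obtain ⟨x', ⟨p, hp, hh⟩, h2, h3⟩ := this.exists
    exact ⟨x', p, h2, h3, hp, hh⟩
  choose X P hXC hXd hP hH using hev
  choose Y hYd hYne hYX hYP using fun k : ℕ =>
    approx_grad (x := x) (hP k) (Nat.one_div_pos_of_nat (n := k) (α := ℝ))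
  have t0 : Tendsto (fun k : ℕ => 1 / ((k:ℝ) + 1)) atTop (𝓝 0) :=
    tendsto_one_div_add_atTop_nhds_zero_nat
  have tX : Tendsto X atTop (𝓝 x) := tendsto_iff_dist_tendsto_zero.2
    (squeeze_zero (fun _ => dist_nonneg) (fun k => (hXd k).le) t0)
  have tYX : Tendsto (fun k => dist (Y k) (X k)) atTop (𝓝 0) :=
    squeeze_zero (fun _ => dist_nonneg) (fun k => (hYX k).le) t0
  have tY : Tendsto Y atTop (𝓝 x) :=
    (tendsto_iff_of_dist tYX).2 tX
  have tYP : Tendsto (fun k => dist (gradient W (Y k)) (P k)) atTop (𝓝 0) :=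
    squeeze_zero (fun _ => dist_nonneg) (fun k => (hYP k).le) t0
  have hbdd : ∃ᶠ k in atTop, gradient W (Y k) ∈ closedBall (0 : Euc n) M := by
    apply Eventually.frequently
    filter_upwards [tY (ball_mem_nhds x hδ)] with k hk
    rw [mem_closedBall_zero_iff]
    exact hM _ hk (hYd k)
  obtain ⟨p, -, φ, hφ, tG⟩ := tendsto_subseq_of_frequently_bounded isBounded_closedBall hbdd
  have hpD : p ∈ limitingGradients W x :=
    ⟨Y ∘ φ, fun k => ⟨hYd _, hYne _⟩, tY.comp hφ.tendsto_atTop, tG⟩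
  have tP : Tendsto (P ∘ φ) atTop (𝓝 p) :=
    (tendsto_iff_of_dist (tYP.comp hφ.tendsto_atTop)).1 tG
  have tXφ : Tendsto (X ∘ φ) atTop (𝓝 x) := tX.comp hφ.tendsto_atTop
  have hlt := hneg x hx p hpD
  have hUne : U.Nonempty := by
    by_contra h
    rw [Set.not_nonempty_iff_eq_empty] at h
    simp [Ham, h] at hlt
  obtain ⟨_, ⟨u, hu, rfl⟩, hlt'⟩ := exists_lt_of_csInf_lt (hUne.image _) hlt
  simp only at hlt'
  obtain ⟨ε, hε, hball⟩ := Metric.nhds_basis_closedBall.mem_iff.1 (hC.isOpen_compl.mem_nhds hx)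
  obtain ⟨uf, ul⟩ := huc (closedBall x ε) (isCompact_closedBall x ε) hball
  have hxm : (x, u) ∈ closedBall x ε ×ˢ U := ⟨mem_closedBall_self hε.le, hu⟩
  have tpair : Tendsto (fun k => (X (φ k), u)) atTop (𝓝[closedBall x ε ×ˢ U] (x, u)) := by
    rw [tendsto_nhdsWithin_iff]
    refine ⟨tXφ.prodMk_nhds tendsto_const_nhds, ?_⟩
    filter_upwards [tXφ (closedBall_mem_nhds x hε)] with k hk
    exact ⟨hk, hu⟩
  have tf := (uf.continuousOn (x, u) hxm).tendsto.comp tpair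
  have tl := (ul.continuousOn (x, u) hxm).tendsto.comp tpair
  have tval : Tendsto (fun k => ⟪P (φ k), f (X (φ k)) u⟫ + p0 * l (X (φ k)) u) atTop
      (𝓝 (⟪p, f x u⟫ + p0 * l x u)) := (tP.inner tf).add (tl.const_mul p0)
  have hle : ∀ k, -(1 / ((φ k:ℝ) + 1)) ≤ ⟪P (φ k), f (X (φ k)) u⟫ + p0 * l (X (φ k)) u := by
    intro k
    refine (hH (φ k)).le.trans (csInf_le ?_ ⟨u, hu, rfl⟩)
    obtain ⟨M', hM', hb⟩ := hbd (dC C (X (φ k)) + 1)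
      (by have : 0 ≤ dC C (X (φ k)) := infDist_nonneg
          linarith)
    refine ⟨-(‖P (φ k)‖ * M'), ?_⟩
    rintro _ ⟨v, hv, rfl⟩
    have h1 := (hb (X (φ k)) v (by linarith) (hXC _) hv).1
    have h2 := mul_nonneg hp0 (hl (X (φ k)) v hv)
    have h3 := (abs_le.1 (abs_real_inner_le_norm (P (φ k)) (f (X (φ k)) v))).1
    have h4 := mul_le_mul_of_nonneg_left h1 (norm_nonneg (P (φ k)))
    simp only; linarith
  have tn : Tendsto (fun k => -(1 / ((φ k:ℝ) + 1))) atTop (𝓝 (-0)) :=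
    (t0.comp hφ.tendsto_atTop).neg
  have := le_of_tendsto_of_tendsto' tn tval hle
  linarith

/-- Proposition 4.6: a `p₀`-OMRF admits, for every `σ > 0`, a continuous increasing
local rate function `γ_σ` on `(0,σ]`. -/
theorem omrf_admits_local_rate_function
    {n m : ℕ} (C : Set (Euc n)) (U : Set (Euc m))
    (f : Euc n → Euc m → Euc n) (l : Euc n → Euc m → ℝ)
    (p0 : ℝ) (W : Euc n → ℝ)
    (hH0 : HypH0 C U f l) (hp0 : 0 ≤ p0) (hW : IsOMRF C U f l p0 W) :
    ∀ σ : ℝ, 0 < σ → ∃ γσ : ℝ → ℝ,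
      ContinuousOn γσ (Set.Ioc 0 σ) ∧ MonotoneOn γσ (Set.Ioc 0 σ) ∧
      (∀ r ∈ Set.Ioc (0:ℝ) σ, 0 < γσ r) ∧
      ∀ x, x ∉ C → 0 < W x → W x ≤ σ → ∀ p ∈ limitingGradients W x,
        Ham U f l p0 x p < -γσ (W x) := by
  intro σ hσ
  have hW' := hW
  obtain ⟨hcont, -, hsc, hpd, hprop, hneg⟩ := hW'
  have hex := rate_aux
    {a : ℝ × ℝ | ∃ x, x ∉ C ∧ W x ≤ σ ∧ ∃ p ∈ limitingGradients W x,
      a = (W x, -Ham U f l p0 x p)} ?_ ?_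
  · obtain ⟨γ, g1, g2, g3, g4⟩ := hex
    refine ⟨γ, g1.continuousOn, g2.monotoneOn _, fun r hr => g3 r hr.1, ?_⟩
    intro x hx h0 hxσ p hp
    have := g4 (W x, -Ham U f l p0 x p) ⟨x, hx, hxσ, p, hp, rfl⟩ h0
    simp only at this
    linarith
  · intro r hr
    have hK : IsCompact (closure Cᶜ ∩ W ⁻¹' Set.Icc r σ) :=
      hprop _ isCompact_Icc (fun t ht => hr.le.trans ht.1)
    have hKC : ∀ x ∈ closure Cᶜ ∩ W ⁻¹' Set.Icc r σ, x ∉ C := by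
      rintro x ⟨hx1, hx2⟩ hxC
      have hf : x ∈ frontier C := by
        rw [frontier_eq_closure_inter_closure]
        exact ⟨subset_closure hxC, hx1⟩
      have h1 := hpd.2 x hf
      have h2 : r ≤ W x := hx2.1
      linarith
    have hmain : ∃ c > (0:ℝ), ∀ x ∈ closure Cᶜ ∩ W ⁻¹' Set.Icc r σ,
        ∀ p ∈ limitingGradients W x, Ham U f l p0 x p ≤ -c := by
      refine hK.induction_on (p := fun s => ∃ c > (0:ℝ), ∀ x ∈ s,
        ∀ p ∈ limitingGradients W x, Ham U f l p0 x p ≤ -c) ?_ ?_ ?_ ?_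
      · exact ⟨1, one_pos, by simp⟩
      · rintro s t hst ⟨c, hc, h⟩
        exact ⟨c, hc, fun x hx => h x (hst hx)⟩
      · rintro s t ⟨c, hc, h⟩ ⟨d, hd, h'⟩
        refine ⟨min c d, lt_min hc hd, ?_⟩
        rintro x (hx | hx) p hp
        · linarith [h x hx p hp, min_le_left c d]
        · linarith [h' x hx p hp, min_le_right c d]
      · intro x hx
        obtain ⟨c, hc, h⟩ := local_rate C U f l p0 W hH0 hp0 hW (hKC x hx)
        exact ⟨_, mem_nhdsWithin_of_mem_nhds h, c, hc, fun x' hx' => hx'⟩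
    obtain ⟨c, hc, h⟩ := hmain
    refine ⟨c, hc, ?_⟩
    rintro _ ⟨x, hx, hxσ, p, hp, rfl⟩ hrx
    have := h x ⟨subset_closure hx, hrx, hxσ⟩ p hp
    simp only; linarith
  · rintro _ ⟨x, hx, hxσ, p, hp, rfl⟩
    have := hneg x hx p hp
    simp only; linarith
end

section
/- Assume hypothesis (H1) and let p₀ ≥ 0. Let W : closure(ℝⁿ ∖ C) → [0,∞) be locally Lipschitz continuous on closure(ℝⁿ ∖ C), positive definite and proper on ℝⁿ ∖ C, and suppose H(x,p₀,p) < 0 for every x ∈ ℝⁿ ∖ C and every p ∈ ∂_L W(x). Then there exists a (p₀/2)-OMRF W̄ which moreover satisfies W̄(x) ≤ W(x) for all x ∈ ℝⁿ ∖ C. -/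
open Filter Topology Metric MeasureTheory Bornology
open scoped RealInnerProductSpace ENNReal NNReal

theorem aux_bump {n : ℕ} (O : Set (Euc n)) (hO : IsOpen O) (E : Euc n → ℝ)
    (hE : ∀ x0 ∈ O, ∃ e > (0:ℝ), ∃ r > (0:ℝ), ∀ x ∈ ball x0 r, e ≤ E x) (x0 : Euc n)
    (hx0 : x0 ∈ O) :
    ∃ g : Euc n → ℝ, ContDiff ℝ 2 g ∧ (∀ x, 0 ≤ g x) ∧ 0 < g x0 ∧ Function.support g ⊆ O ∧
      (∀ i ≤ 2, ∀ x, ‖iteratedFDeriv ℝ i g x‖ ≤ 1) ∧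
      (∀ i ≤ 2, ∀ x ∈ O, ‖iteratedFDeriv ℝ i g x‖ ≤ E x) := by
  obtain ⟨e, he, r, hr, hb⟩ := hE x0 hx0
  have hEpos : ∀ x ∈ O, 0 ≤ E x := by
    intro x hx
    obtain ⟨e, he, r, hr, hb⟩ := hE x hx
    exact he.le.trans (hb x (mem_ball_self hr))
  have hs : ball x0 r ∩ O ∈ 𝓝 x0 := inter_mem (ball_mem_nhds _ hr) (hO.mem_nhds hx0)
  obtain ⟨g, hgs, hgc, hgd, hgr, hg1⟩ := exists_contDiff_tsupport_subset (n := 2) hs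
  have : ∀ i : ℕ, ∃ R, i ≤ 2 → ∀ x, ‖iteratedFDeriv ℝ i g x‖ ≤ R := by
    intro i
    by_cases hi : i ≤ 2
    · obtain ⟨R, hR⟩ := (hgd.continuous_iteratedFDeriv (m := i)
        (by exact_mod_cast hi)).bounded_above_of_compact_support (hgc.iteratedFDeriv i)
      exact ⟨R, fun _ => hR⟩
    · exact ⟨0, fun h => absurd h hi⟩
  choose R hR using this
  set M := |R 0| + |R 1| + |R 2| + 1 with hM
  have hMpos : 0 < M := by positivity
  have hRM : ∀ i ≤ 2, ∀ x, ‖iteratedFDeriv ℝ i g x‖ ≤ M := by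
    intro i hi x
    refine (hR i hi x).trans ?_
    have h0 := abs_nonneg (R 0); have h1 := abs_nonneg (R 1); have h2 := abs_nonneg (R 2)
    have := le_abs_self (R i)
    interval_cases i <;> linarith
  set c := min e 1 / M with hc
  have hcpos : 0 < c := by positivity
  have hit : ∀ i ≤ 2, ∀ x, ‖iteratedFDeriv ℝ i (c • g) x‖ ≤ min e 1 := by
    intro i hi x
    rw [iteratedFDeriv_const_smul_apply
      (hgd.contDiffAt.of_le (by exact_mod_cast hi)), norm_smul, Real.norm_of_nonneg hcpos.le]
    calc c * _ ≤ c * M := by gcongr; exact hRM i hi x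
      _ = min e 1 := by rw [hc]; field_simp
  have hz : ∀ i ≤ 2, ∀ x, x ∉ ball x0 r → iteratedFDeriv ℝ i (c • g) x = 0 := by
    intro i hi x hx
    rw [iteratedFDeriv_const_smul_apply
      (hgd.contDiffAt.of_le (by exact_mod_cast hi))]
    have : x ∉ tsupport (iteratedFDeriv ℝ i g) := fun h =>
      hx (hgs (tsupport_iteratedFDeriv_subset i h)).1
    rw [image_eq_zero_of_notMem_tsupport this, smul_zero]
  refine ⟨c • g, hgd.const_smul c, ?_, ?_, ?_, ?_, ?_⟩
  · intro x
    exact mul_nonneg hcpos.le (hgr (Set.mem_range_self x)).1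
  · simp [hg1, hcpos]
  · intro x hx
    have : g x ≠ 0 := by
      intro h; exact hx (by simp [h])
    exact (hgs (subset_tsupport _ this)).2
  · intro i hi x
    exact (hit i hi x).trans (min_le_right _ _)
  · intro i hi x hx
    by_cases hxb : x ∈ ball x0 r
    · exact (hit i hi x).trans ((min_le_left _ _).trans (hb x hxb))
    · rw [hz i hi x hxb, norm_zero]; exact hEpos x hx

theorem aux_eps {n : ℕ} (O : Set (Euc n)) (hO : IsOpen O) (E : Euc n → ℝ)
    (hE : ∀ x0 ∈ O, ∃ e > (0:ℝ), ∃ r > (0:ℝ), ∀ x ∈ ball x0 r, e ≤ E x) :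
    ∃ ε : Euc n → ℝ, ContDiff ℝ 2 ε ∧ ∀ x ∈ O, 0 < ε x ∧ ε x ≤ E x ∧ ‖fderiv ℝ ε x‖ ≤ E x := by
  rcases Set.eq_empty_or_nonempty O with rfl | hne
  · exact ⟨fun _ => 0, contDiff_const, by simp⟩
  have hb := aux_bump O hO E hE
  choose! g hgd hg0 hgx hgs hg1 hgE using hb
  obtain ⟨T, hTO, hTc, hT⟩ : ∃ T : Set (Euc n), T ⊆ O ∧ T.Countable ∧
      O ⊆ ⋃ x ∈ T, Function.support (g x) := by
    obtain ⟨T, h1, h2, h3⟩ := TopologicalSpace.countable_cover_nhdsWithin (s := O)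
      (f := fun x => Function.support (g x)) (fun x hx => mem_nhdsWithin_of_mem_nhds
        ((hgd x hx).continuous.isOpen_support.mem_nhds (hgx x hx).ne'))
    exact ⟨T, h1, h2, h3⟩
  have hTne : T.Nonempty := by
    obtain ⟨x, hx⟩ := hne
    have := hT hx
    simp only [Set.mem_iUnion] at this
    obtain ⟨y, hy, _⟩ := this
    exact ⟨y, hy⟩
  obtain ⟨t, ht⟩ := hTc.exists_eq_range hTne
  have htO : ∀ i, t i ∈ O := fun i => hTO (ht ▸ Set.mem_range_self i)
  let a : ℕ → ℝ := fun i => (1/2:ℝ) / 2 ^ i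
  have hapos : ∀ i, 0 < a i := fun i => by positivity
  have hasum : HasSum a 1 := by
    have := hasSum_geometric_two' (1:ℝ)
    exact this
  let h : ℕ → Euc n → ℝ := fun i => a i • g (t i)
  have hhd : ∀ i, ContDiff ℝ 2 (h i) := fun i => by
    change ContDiff ℝ 2 (a i • g (t i))
    exact (hgd _ (htO i)).const_smul (a i)
  have hhi : ∀ i k, k ≤ 2 → ∀ x, ‖iteratedFDeriv ℝ k (h i) x‖ = a i * ‖iteratedFDeriv ℝ k (g (t i)) x‖ := by
    intro i k hk x
    rw [iteratedFDeriv_const_smul_apply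
      ((hgd _ (htO i)).contDiffAt.of_le (by exact_mod_cast hk)), norm_smul,
      Real.norm_of_nonneg (hapos i).le]
  have hh1 : ∀ i k, k ≤ 2 → ∀ x, ‖iteratedFDeriv ℝ k (h i) x‖ ≤ a i := by
    intro i k hk x
    rw [hhi i k hk]
    exact mul_le_of_le_one_right (hapos i).le (hg1 _ (htO i) k hk x)
  have hhE : ∀ i k, k ≤ 2 → ∀ x ∈ O, ‖iteratedFDeriv ℝ k (h i) x‖ ≤ a i * E x := by
    intro i k hk x hx
    rw [hhi i k hk]
    exact mul_le_mul_of_nonneg_left (hgE _ (htO i) k hk x hx) (hapos i).le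
  have hsumm : ∀ x, Summable fun i => h i x := by
    intro x
    refine Summable.of_norm_bounded hasum.summable (fun i => ?_)
    have := hh1 i 0 (by norm_num) x
    rwa [norm_iteratedFDeriv_zero] at this
  have hhnn : ∀ i x, 0 ≤ h i x := fun i x => mul_nonneg (hapos i).le (hg0 _ (htO i) x)
  refine ⟨fun x => ∑' i, h i x, ?_, ?_⟩
  · refine contDiff_tsum (N := 2) (v := fun _ i => a i) hhd (fun _ _ => hasum.summable) ?_
    intro k i x hk
    exact hh1 i k (by exact_mod_cast hk) x
  · intro x hx
    have hEs : HasSum (fun i => a i * E x) (E x) := by simpa using hasum.mul_right (E x)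
    refine ⟨?_, ?_, ?_⟩
    · have := hT hx
      simp only [Set.mem_iUnion] at this
      obtain ⟨y, hy, hxy⟩ := this
      rw [ht] at hy
      obtain ⟨i, rfl⟩ := hy
      refine (hsumm x).tsum_pos (fun i => hhnn i x) i ?_
      exact mul_pos (hapos i) (lt_of_le_of_ne (hg0 _ (htO i) x) (Ne.symm hxy))
    · refine hasSum_le (fun i => ?_) (hsumm x).hasSum hEs
      have := hhE i 0 (by norm_num) x hx
      rw [norm_iteratedFDeriv_zero] at this
      exact (le_abs_self _).trans this
    · have h1 : ∀ i x, ‖fderiv ℝ (h i) x‖ ≤ a i := by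
        intro i x
        rw [← norm_iteratedFDeriv_one]; exact hh1 i 1 (by norm_num) x
      rw [fderiv_tsum hasum.summable (fun i => (hhd i).differentiable (by norm_num)) h1 (hsumm x)]
      refine tsum_of_norm_bounded hEs (fun i => ?_)
      rw [← norm_iteratedFDeriv_one]; exact hhE i 1 (by norm_num) x hx

theorem aux_choose {n : ℕ} (O : Set (Euc n)) (R : Euc n → ℝ → Prop)
    (hanti : ∀ x e e', 0 < e' → e' ≤ e → R x e → R x e')
    (hloc : ∀ x0 ∈ O, ∃ e > (0:ℝ), ∃ r > (0:ℝ), ∀ x ∈ ball x0 r, R x e) :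
    ∃ E : Euc n → ℝ, (∀ x ∈ O, 0 < E x ∧ E x ≤ 1 ∧ R x (E x)) ∧
      ∀ x0 ∈ O, ∃ e > (0:ℝ), ∃ r > (0:ℝ), ∀ x ∈ ball x0 r, e ≤ E x := by
  let A : Euc n → Set ℝ := fun x => {e | 0 < e ∧ e ≤ 1 ∧ R x e}
  have hbdd : ∀ x, BddAbove (A x) := fun x => ⟨1, fun e he => he.2.1⟩
  have hl : ∀ x0 ∈ O, ∃ e > (0:ℝ), ∃ r > (0:ℝ), ∀ x ∈ ball x0 r, e ≤ sSup (A x) / 2 := by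
    intro x0 hx0
    obtain ⟨e, he, r, hr, h⟩ := hloc x0 hx0
    refine ⟨min e 1 / 2, by positivity, r, hr, fun x hx => ?_⟩
    have : min e 1 ≤ sSup (A x) := le_csSup (hbdd x)
      ⟨by positivity, min_le_right _ _, hanti x e _ (by positivity) (min_le_left _ _) (h x hx)⟩
    linarith
  refine ⟨fun x => sSup (A x) / 2, fun x hx => ?_, hl⟩
  obtain ⟨e, he, r, hr, h⟩ := hl x hx
  have hpos : 0 < sSup (A x) / 2 := lt_of_lt_of_le he (h x (mem_ball_self hr))
  have hne : (A x).Nonempty := by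
    by_contra hc
    rw [Set.not_nonempty_iff_eq_empty] at hc
    rw [hc] at hpos; simp at hpos
  have hle : sSup (A x) ≤ 1 := csSup_le hne (fun e he => he.2.1)
  obtain ⟨e', he', hlt⟩ := exists_lt_of_lt_csSup hne (show sSup (A x) / 2 < sSup (A x) by linarith)
  exact ⟨hpos, by linarith, hanti x e' _ hpos hlt.le he'.2.2⟩

theorem aux_prox_bound {n : ℕ} (W : Euc n → ℝ) (K : ℝ≥0) (t : Set (Euc n)) (y q : Euc n)
    (ht : t ∈ 𝓝 y) (hW : LipschitzOnWith K W t) (hq : q ∈ proxSubdiff W y) : ‖q‖ ≤ K := by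
  obtain ⟨σ, hσ, η, hη, h⟩ := hq
  by_contra hc
  push Not at hc
  have hq0 : 0 < ‖q‖ := lt_of_le_of_lt K.2 hc
  have h1 : Tendsto (fun s : ℝ => y + s • q) (𝓝[>] 0) (𝓝 y) := by
    have : Continuous (fun s : ℝ => y + s • q) := by fun_prop
    have := this.tendsto 0
    simp only [zero_smul, add_zero] at this
    exact this.mono_left nhdsWithin_le_nhds
  have h2 : Tendsto (fun s : ℝ => σ * s * ‖q‖) (𝓝[>] 0) (𝓝 0) := by
    have : Continuous (fun s : ℝ => σ * s * ‖q‖) := by fun_prop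
    have := this.tendsto 0
    simp only [mul_zero, zero_mul] at this
    exact this.mono_left nhdsWithin_le_nhds
  obtain ⟨s, hs1, hs2, hs3, hs4⟩ := (((h1.eventually ht).and ((h1.eventually (closedBall_mem_nhds y hη)).and
    ((h2.eventually (gt_mem_nhds (sub_pos.2 hc))).and self_mem_nhdsWithin)))).exists
  have hs4' : 0 < s := hs4
  have a1 := h (y + s • q) (by simpa [dist_eq_norm] using hs2)
  have a2 := hW.dist_le_mul _ hs1 _ (mem_of_mem_nhds ht)
  rw [Real.dist_eq, dist_eq_norm] at a2
  have a3 := (le_abs_self _).trans a2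
  simp only [add_sub_cancel_left, inner_smul_right, real_inner_self_eq_norm_sq, norm_smul,
    Real.norm_of_nonneg hs4'.le] at a1 a3
  have : s * ‖q‖ * (‖q‖ - K - σ * s * ‖q‖) ≤ 0 := by nlinarith
  have : 0 < s * ‖q‖ * (‖q‖ - K - σ * s * ‖q‖) := mul_pos (by positivity) (by linarith)
  linarith

theorem aux_local_global {n : ℕ} (C : Set (Euc n)) (V : Euc n → ℝ)
    (hc : ContinuousOn V Cᶜ)
    (hloc : ∀ x0 ∉ C, ∃ r > (0:ℝ), ∃ ρ : ℝ, ∀ x ∈ ball x0 r, ∀ y ∈ ball x0 r,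
      V x + V y - 2 * V (midpoint ℝ x y) ≤ ρ * ‖x - y‖ ^ 2) : LocSemiconcaveOn C V := by
  intro S hS hSC
  choose! r hr ρ hρ using hloc
  obtain ⟨T, hTS, hT⟩ := hS.elim_nhds_subcover (fun x => ball x (r x))
    (fun x hx => ball_mem_nhds _ (hr x (hSC hx)))
  obtain ⟨δ, hδ, hδ'⟩ := lebesgue_number_lemma_of_metric (c := fun x : T => ball (x:Euc n) (r x)) hS
    (fun _ => isOpen_ball) (by intro x hx; have := hT hx; simpa using this)
  obtain ⟨M, hM⟩ := hS.exists_bound_of_continuousOn (hc.mono hSC)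
  refine ⟨(∑ x ∈ T, |ρ x|) + 4 * |M| / δ ^ 2 + 1, by positivity, fun x y hxy => ?_⟩
  have hx : x ∈ S := hxy (left_mem_segment ℝ x y)
  have hy : y ∈ S := hxy (right_mem_segment ℝ x y)
  have hm : midpoint ℝ x y ∈ S := hxy (midpoint_mem_segment x y)
  have hsum : 0 ≤ ∑ x ∈ T, |ρ x| := Finset.sum_nonneg (fun _ _ => abs_nonneg _)
  by_cases hd : ‖x - y‖ < δ
  · obtain ⟨i, hi⟩ := hδ' x hx
    have h1 := hρ i (hSC (hTS i i.2)) x (hi (mem_ball_self hδ)) y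
      (hi (by rw [mem_ball, dist_comm, dist_eq_norm]; exact hd))
    refine h1.trans ?_
    gcongr
    have : |ρ i| ≤ ∑ x ∈ T, |ρ x| := Finset.single_le_sum (f := fun x => |ρ x|) (fun _ _ => abs_nonneg _) i.2
    have := le_abs_self (ρ i)
    have : 0 ≤ 4 * |M| / δ ^ 2 := by positivity
    linarith
  · push Not at hd
    have b1 := (le_abs_self _).trans (hM x hx)
    have b2 := (le_abs_self _).trans (hM y hy)
    have b3 := (neg_abs_le _).trans' (neg_le_neg (hM _ hm))
    have b4 := le_abs_self M
    have : V x + V y - 2 * V (midpoint ℝ x y) ≤ 4 * |M| := by linarith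
    refine this.trans ?_
    calc 4 * |M| = 4 * |M| / δ ^ 2 * δ ^ 2 := by field_simp
      _ ≤ ((∑ x ∈ T, |ρ x|) + 4 * |M| / δ ^ 2 + 1) * ‖x - y‖ ^ 2 := by
        gcongr
        linarith

theorem aux_c2_local {n : ℕ} (k : Euc n → ℝ) (x0 : Euc n) (hk : ContDiffAt ℝ 2 k x0) :
    ∃ r > (0:ℝ), ∃ M > (0:ℝ), ∀ x ∈ ball x0 r, ∀ z ∈ ball x0 r,
      |k x| ≤ M ∧ |k x - k z| ≤ M * ‖x - z‖ ∧
      k x + k z - 2 * k (midpoint ℝ x z) ≤ M * ‖x - z‖ ^ 2 := by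
  obtain ⟨K1, t1, ht1, hK1⟩ := (hk.of_le (show (1:WithTop ℕ∞) ≤ 2 by norm_num)).exists_lipschitzOnWith
  have hf : ContDiffAt ℝ 1 (fderiv ℝ k) x0 := hk.fderiv_right (by norm_num)
  obtain ⟨K2, t2, ht2, hK2⟩ := hf.exists_lipschitzOnWith
  have hd : ∀ᶠ x in 𝓝 x0, DifferentiableAt ℝ k x := by
    have := hk.eventually (by norm_num)
    exact this.mono fun x hx => hx.differentiableAt (by norm_num)
  have hbd : ∀ᶠ x in 𝓝 x0, |k x| < |k x0| + 1 :=
    (hk.continuousAt.abs).eventually (gt_mem_nhds (by linarith))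
  obtain ⟨r, hr, hball⟩ := Metric.eventually_nhds_iff_ball.1
    ((eventually_mem_set.2 ht1).and ((eventually_mem_set.2 ht2).and (hd.and hbd)))
  refine ⟨r, hr, |k x0| + 1 + K1 + K2, by positivity, fun x hx z hz => ?_⟩
  have hK1n := K1.2
  have hK2n := K2.2
  have hk0 := abs_nonneg (k x0)
  obtain ⟨hx1, hx2, hx3, hx4⟩ := hball x hx
  obtain ⟨hz1, hz2, hz3, hz4⟩ := hball z hz
  set m := midpoint ℝ x z with hm
  have hmb : m ∈ ball x0 r := (convex_ball x0 r).segment_subset hx hz (midpoint_mem_segment x z)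
  refine ⟨by linarith [show (0:ℝ) ≤ K1 from hK1n, show (0:ℝ) ≤ K2 from hK2n], ?_, ?_⟩
  · have := hK1.dist_le_mul x hx1 z hz1
    rw [Real.dist_eq, dist_eq_norm] at this
    refine this.trans ?_
    gcongr
    linarith [show (0:ℝ) ≤ K2 from hK2n]
  · have key : ∀ w ∈ ball x0 r, |k w - k m - fderiv ℝ k m (w - m)| ≤ K2 * ‖w - m‖ * ‖w - m‖ := by
      intro w hw
      refine Convex.norm_image_sub_le_of_norm_hasFDerivWithin_le' (f := k) (f' := fderiv ℝ k)
        (s := segment ℝ m w) ?_ ?_ (convex_segment m w) (left_mem_segment ℝ m w) (right_mem_segment ℝ m w)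
      · intro v hv
        exact (hball v ((convex_ball x0 r).segment_subset hmb hw hv)).2.2.1.hasFDerivAt.hasFDerivWithinAt
      · intro v hv
        have := hK2.dist_le_mul v (hball v ((convex_ball x0 r).segment_subset hmb hw hv)).2.1 m (hball m hmb).2.1
        rw [dist_eq_norm, dist_eq_norm] at this
        refine this.trans ?_
        gcongr
        obtain ⟨a, b, ha, hb, hab, rfl⟩ := hv
        have : a • m + b • w - m = b • (w - m) := by
          have : a = 1 - b := by linarith
          rw [this]; module
        rw [this, norm_smul, Real.norm_of_nonneg hb]
        exact mul_le_of_le_one_left (norm_nonneg _) (by linarith)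
    have e1 : x - m = (1/2:ℝ) • (x - z) := by
      rw [hm, midpoint_eq_smul_add, invOf_eq_inv]; module
    have e2 : z - m = -((1/2:ℝ) • (x - z)) := by
      rw [hm, midpoint_eq_smul_add, invOf_eq_inv]; module
    have k1 := le_of_abs_le (key x hx)
    have k2 := le_of_abs_le (key z hz)
    rw [e1] at k1
    rw [e2, map_neg, norm_neg] at k2
    have e3 : ‖(1/2:ℝ) • (x - z)‖ = 1/2 * ‖x - z‖ := by
      rw [norm_smul]; norm_num
    rw [e3] at k1 k2
    have hK2' : (0:ℝ) ≤ K2 := hK2n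
    have hK1' : (0:ℝ) ≤ K1 := hK1n
    have p1 : 0 ≤ (K2:ℝ) * ‖x - z‖ ^ 2 := by positivity
    have p2 : 0 ≤ (K1:ℝ) * ‖x - z‖ ^ 2 := by positivity
    have p3 : 0 ≤ |k x0| * ‖x - z‖ ^ 2 := by positivity
    have p4 : 0 ≤ ‖x - z‖ ^ 2 := by positivity
    nlinarith

def QProp {n m : ℕ} (U : Set (Euc m)) (f : Euc n → Euc m → Euc n)
    (l : Euc n → Euc m → ℝ) (p0 : ℝ) (W : Euc n → ℝ) (x' : Euc n) (e : ℝ) : Prop :=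
  ∀ x y p q : Euc n, ‖x - x'‖ ≤ e → ‖y - x'‖ ≤ e → q ∈ proxSubdiff W y → ‖p - q‖ ≤ e →
    ∃ u ∈ U, ⟪p, f x u⟫ + p0 * l x u < 0


theorem aux_Q_local {n m : ℕ} (C : Set (Euc n)) (U : Set (Euc m))
    (f : Euc n → Euc m → Euc n) (l : Euc n → Euc m → ℝ)
    (p0 : ℝ) (W : Euc n → ℝ)
    (hH1 : HypH1 C U f l)
    (hWlip : LocLipschitzOn (closure Cᶜ) W)
    (hdec : ∀ x, x ∉ C → ∀ p ∈ limitingSubdiff W x, Ham U f l p0 x p < 0)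
    (x0 : Euc n) (hx0 : x0 ∉ C) :
    ∃ e > (0:ℝ), ∃ r > (0:ℝ), ∀ x ∈ ball x0 r, QProp U f l p0 W x e := by
  obtain ⟨hCc, -, -, -, hfc, hlc, -⟩ := hH1
  have hO : IsOpen Cᶜ := hCc.isOpen_compl
  have hcl : closure Cᶜ ∈ 𝓝 x0 := mem_of_superset (hO.mem_nhds hx0) subset_closure
  obtain ⟨K, t, ht, hK⟩ := hWlip x0 (subset_closure hx0)
  rw [nhdsWithin_eq_nhds.2 hcl] at ht
  by_contra hcon
  push Not at hcon
  have hpos : ∀ j : ℕ, (0:ℝ) < 1 / ((j:ℝ) + 1) := fun j => by positivity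
  have : ∀ j : ℕ, ∃ x' x y p q : Euc n, ‖x' - x0‖ ≤ 1 / ((j:ℝ) + 1) ∧ ‖x - x'‖ ≤ 1 / ((j:ℝ) + 1) ∧
      ‖y - x'‖ ≤ 1 / ((j:ℝ) + 1) ∧ q ∈ proxSubdiff W y ∧ ‖p - q‖ ≤ 1 / ((j:ℝ) + 1) ∧
      ∀ u ∈ U, 0 ≤ ⟪p, f x u⟫ + p0 * l x u := by
    intro j
    obtain ⟨x', hx', hQ⟩ := hcon _ (hpos j) _ (hpos j)
    unfold QProp at hQ
    push Not at hQ
    obtain ⟨x, y, p, q, h1, h2, h3, h4, h5⟩ := hQ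
    rw [mem_ball, dist_eq_norm] at hx'
    exact ⟨x', x, y, p, q, hx'.le, h1, h2, h3, h4, h5⟩
  choose x' x y p q h0 h1 h2 h3 h4 h5 using this
  have hlim : Tendsto (fun j : ℕ => 1 / ((j:ℝ) + 1)) atTop (𝓝 0) := tendsto_one_div_add_atTop_nhds_zero_nat
  have hx't : Tendsto x' atTop (𝓝 x0) :=
    tendsto_iff_norm_sub_tendsto_zero.2 (squeeze_zero (fun _ => norm_nonneg _) h0 hlim)
  have hxx : Tendsto (fun j => x j - x' j) atTop (𝓝 0) :=
    squeeze_zero_norm h1 hlim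
  have hyy : Tendsto (fun j => y j - x' j) atTop (𝓝 0) :=
    squeeze_zero_norm h2 hlim
  have hpq : Tendsto (fun j => p j - q j) atTop (𝓝 0) :=
    squeeze_zero_norm h4 hlim
  have hxt : Tendsto x atTop (𝓝 x0) := by simpa using hxx.add hx't
  have hyt : Tendsto y atTop (𝓝 x0) := by simpa using hyy.add hx't
  have hqb : ∀ᶠ j in atTop, q j ∈ closedBall (0 : Euc n) K := by
    have := hyt.eventually (eventually_mem_nhds_iff.2 ht)
    filter_upwards [this] with j hj
    rw [mem_closedBall_zero_iff]
    exact aux_prox_bound W K t (y j) (q j) hj hK (h3 j)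
  obtain ⟨q0, -, φ, hφ, hq0⟩ := (isCompact_closedBall (0 : Euc n) K).tendsto_subseq' hqb.frequently
  have hmem : q0 ∈ limitingSubdiff W x0 :=
    ⟨y ∘ φ, q ∘ φ, fun j => h3 _, hyt.comp hφ.tendsto_atTop, hq0⟩
  have hH := hdec x0 hx0 q0 hmem
  unfold Ham at hH
  have hne : ((fun u => ⟪q0, f x0 u⟫ + p0 * l x0 u) '' U).Nonempty := by
    by_contra hc
    rw [Set.not_nonempty_iff_eq_empty] at hc
    rw [hc, Real.sInf_empty] at hH
    exact lt_irrefl _ hH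
  obtain ⟨_, ⟨u, hu, rfl⟩, hlt⟩ := exists_lt_of_csInf_lt hne hH
  have hpt : Tendsto (p ∘ φ) atTop (𝓝 q0) := by
    have := (hpq.comp hφ.tendsto_atTop).add hq0
    simpa [Function.comp_def] using this
  have hxφ : Tendsto (x ∘ φ) atTop (𝓝 x0) := hxt.comp hφ.tendsto_atTop
  have hpair : Tendsto (fun j => (x (φ j), u)) atTop (𝓝[closure Cᶜ ×ˢ U] (x0, u)) := by
    refine tendsto_nhdsWithin_iff.2 ⟨hxφ.prodMk_nhds tendsto_const_nhds, ?_⟩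
    filter_upwards [hxφ.eventually hcl] with j hj
    exact ⟨hj, hu⟩
  have hf' : Tendsto (fun j => f (x (φ j)) u) atTop (𝓝 (f x0 u)) :=
    (hfc (x0, u) ⟨subset_closure hx0, hu⟩).tendsto.comp hpair
  have hl' : Tendsto (fun j => l (x (φ j)) u) atTop (𝓝 (l x0 u)) :=
    (hlc (x0, u) ⟨subset_closure hx0, hu⟩).tendsto.comp hpair
  have hfin := (hpt.inner hf').add (hl'.const_mul p0)
  exact absurd (ge_of_tendsto' hfin (fun j => h5 (φ j) u hu)) (not_le.2 hlt)

theorem aux_lip_local {n : ℕ} (C : Set (Euc n)) (hC : IsClosed C) (W : Euc n → ℝ)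
    (hWc : ContinuousOn W (closure Cᶜ)) (hWnn : ∀ x ∈ closure Cᶜ, 0 ≤ W x)
    (hWlip : LocLipschitzOn (closure Cᶜ) W)
    (hWpos : ∀ x, x ∉ C → 0 < W x) (x0 : Euc n) (hx0 : x0 ∉ C) :
    ∃ e > (0:ℝ), ∃ r > (0:ℝ), ∀ x ∈ ball x0 r,
      (∀ y ∈ closure Cᶜ, W x - W y ≤ ‖x - y‖ / e) ∧ e ≤ W x := by
  have hO : IsOpen Cᶜ := hC.isOpen_compl
  have hcl : closure Cᶜ ∈ 𝓝 x0 := mem_of_superset (hO.mem_nhds hx0) subset_closure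
  obtain ⟨K, t, ht, hK⟩ := hWlip x0 (subset_closure hx0)
  rw [nhdsWithin_eq_nhds.2 hcl] at ht
  have hca : ContinuousAt W x0 := hWc.continuousAt hcl
  have e1 := hca.eventually (lt_mem_nhds (show W x0 / 2 < W x0 by linarith [hWpos x0 hx0]))
  have e2 := hca.eventually (gt_mem_nhds (show W x0 < W x0 + 1 by linarith))
  obtain ⟨r, hr, hb⟩ := Metric.eventually_nhds_iff_ball.1 ((eventually_mem_set.2 ht).and (e1.and e2))
  have hW0 := hWpos x0 hx0
  set L : ℝ := K + (W x0 + 1) / (r / 2) with hL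
  have hLpos : 0 < L := by positivity
  refine ⟨min (1 / L) (W x0 / 2), by positivity, r / 2, by positivity, fun x hx => ?_⟩
  have hxr : x ∈ ball x0 r := ball_subset_ball (by linarith) hx
  obtain ⟨hx1, hx2, hx3⟩ := hb x hxr
  refine ⟨fun y hy => ?_, (min_le_right _ _).trans hx2.le⟩
  have hle : W x - W y ≤ L * ‖x - y‖ := by
    by_cases hyb : y ∈ ball x0 r
    · have := hK.dist_le_mul x hx1 y (hb y hyb).1
      rw [Real.dist_eq, dist_eq_norm] at this
      refine ((le_abs_self _).trans this).trans ?_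
      gcongr
      rw [hL]
      have : 0 ≤ (W x0 + 1) / (r / 2) := by positivity
      linarith
    · have hd : r / 2 ≤ ‖x - y‖ := by
        rw [mem_ball, not_lt] at hyb
        rw [mem_ball] at hx
        have := dist_triangle y x x0
        rw [dist_comm y x, dist_eq_norm x y] at this
        linarith
      have := hWnn y hy
      calc W x - W y ≤ W x0 + 1 := by linarith
        _ = (W x0 + 1) / (r / 2) * (r / 2) := by field_simp
        _ ≤ L * ‖x - y‖ := by
          gcongr
          rw [hL]; have := K.2; exact le_add_of_nonneg_left this
  refine hle.trans ?_
  rw [le_div_iff₀ (by positivity)]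
  calc L * ‖x - y‖ * min (1 / L) (W x0 / 2) ≤ L * ‖x - y‖ * (1 / L) := by
        gcongr; exact min_le_left _ _
    _ = ‖x - y‖ := by field_simp


/-- Local Lipschitz and semiconcavity estimates for the variable inf-convolution. -/
theorem aux_infconv_local {n : ℕ} (C : Set (Euc n)) (hC : IsClosed C) (W k : Euc n → ℝ)
    (Y : Euc n → Euc n) (V : Euc n → ℝ)
    (hY : ∀ x, x ∉ C → Y x ∉ C)
    (hV : ∀ x, x ∉ C → V x = W (Y x) + k x * ‖x - Y x‖ ^ 2)
    (hmin : ∀ x, x ∉ C → ∀ z, z ∉ C → V x ≤ W z + k x * ‖x - z‖ ^ 2)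
    (hd : ∀ x, x ∉ C → ‖x - Y x‖ ≤ 1)
    (hk : ∀ x, x ∉ C → ContDiffAt ℝ 2 k x) (x0 : Euc n) (hx0 : x0 ∉ C) :
    ContinuousAt V x0 ∧ ∃ r > (0:ℝ), ∃ ρ : ℝ, ∀ x ∈ ball x0 r, ∀ y ∈ ball x0 r,
      V x + V y - 2 * V (midpoint ℝ x y) ≤ ρ * ‖x - y‖ ^ 2 := by
  obtain ⟨r1, hr1, M, hM, hb⟩ := aux_c2_local k x0 (hk x0 hx0)
  obtain ⟨r2, hr2, hb2⟩ := Metric.isOpen_iff.1 hC.isOpen_compl x0 hx0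
  set r := min (min r1 r2) 1 with hr
  have hrpos : 0 < r := by positivity
  have hB1 : ∀ x ∈ ball x0 r, x ∈ ball x0 r1 := fun x hx =>
    ball_subset_ball ((min_le_left _ _).trans (min_le_left _ _)) hx
  have hB2 : ∀ x ∈ ball x0 r, x ∉ C := fun x hx =>
    hb2 (ball_subset_ball ((min_le_left _ _).trans (min_le_right _ _)) hx)
  have hB3 : ∀ x ∈ ball x0 r, ∀ z ∈ ball x0 r, ‖x - z‖ ≤ 2 := by
    intro x hx z hz
    have h1 : dist x x0 < 1 := lt_of_lt_of_le hx (min_le_right _ _)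
    have h2 : dist z x0 < 1 := lt_of_lt_of_le hz (min_le_right _ _)
    rw [← dist_eq_norm]
    linarith [dist_triangle_right x z x0]
  have hlip : ∀ x ∈ ball x0 r, ∀ z ∈ ball x0 r, V x - V z ≤ 13 * M * ‖x - z‖ := by
    intro x hx z hz
    have h1 := hmin x (hB2 x hx) (Y z) (hY z (hB2 z hz))
    rw [hV z (hB2 z hz)]
    obtain ⟨a1, a2, -⟩ := hb x (hB1 x hx) z (hB1 z hz)
    obtain ⟨b1, -, -⟩ := hb z (hB1 z hz) z (hB1 z hz)
    have h3 := hB3 x hx z hz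
    have h4 := hd z (hB2 z hz)
    set A := ‖x - Y z‖
    set B := ‖z - Y z‖
    set D := ‖x - z‖
    have hA0 : 0 ≤ A := norm_nonneg _
    have hB0 : 0 ≤ B := norm_nonneg _
    have hD0 : 0 ≤ D := norm_nonneg _
    have hAB : |A - B| ≤ D := by
      have := abs_norm_sub_norm_le (x - Y z) (z - Y z)
      rwa [sub_sub_sub_cancel_right] at this
    have hA3 : A ≤ 3 := by linarith [le_of_abs_le hAB]
    have t1 : (k x - k z) * A ^ 2 ≤ M * D * 9 := by
      calc (k x - k z) * A ^ 2 ≤ (M * D) * A ^ 2 := by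
            gcongr; exact (le_abs_self _).trans a2
        _ ≤ M * D * 9 := by gcongr; nlinarith
    have t2 : k z * ((A - B) * (A + B)) ≤ M * (D * 4) := by
      calc k z * ((A - B) * (A + B)) ≤ |k z * ((A - B) * (A + B))| := le_abs_self _
        _ = |k z| * (|A - B| * |A + B|) := by rw [abs_mul, abs_mul]
        _ ≤ M * (D * 4) := by
          gcongr
          rw [abs_of_nonneg (by positivity)]; linarith
    nlinarith
  constructor
  · have : LipschitzOnWith (Real.toNNReal (13 * M)) V (ball x0 r) := by
      refine LipschitzOnWith.of_dist_le_mul fun x hx z hz => ?_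
      rw [Real.coe_toNNReal _ (by positivity), Real.dist_eq, dist_eq_norm, abs_le]
      have h1 := hlip x hx z hz
      have h2 := hlip z hz x hx
      rw [norm_sub_rev] at h2
      constructor <;> linarith
    exact this.continuousOn.continuousAt (ball_mem_nhds _ hrpos)
  · refine ⟨r, hrpos, 3 * M, fun x hx z hz => ?_⟩
    set m := midpoint ℝ x z with hm
    have hmb : m ∈ ball x0 r := (convex_ball x0 r).segment_subset hx hz (midpoint_mem_segment x z)
    have hmC := hB2 m hmb
    have h1 := hmin x (hB2 x hx) (Y m) (hY m hmC)
    have h2 := hmin z (hB2 z hz) (Y m) (hY m hmC)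
    rw [hV m hmC]
    obtain ⟨a1, a2, a3⟩ := hb x (hB1 x hx) z (hB1 z hz)
    obtain ⟨b1, -, -⟩ := hb z (hB1 z hz) z (hB1 z hz)
    have h4 := hd m hmC
    set d := (1/2:ℝ) • (x - z) with hdd
    set v := m - Y m with hv
    have e1 : x - Y m = v + d := by
      rw [hv, hdd, hm, midpoint_eq_smul_add, invOf_eq_inv]; module
    have e2 : z - Y m = v - d := by
      rw [hv, hdd, hm, midpoint_eq_smul_add, invOf_eq_inv]; module
    rw [e1, norm_add_sq_real] at h1
    rw [e2, norm_sub_sq_real] at h2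
    have e3 : ‖d‖ = 1/2 * ‖x - z‖ := by
      rw [hdd, norm_smul]; norm_num
    have hD0 : 0 ≤ ‖x - z‖ := norm_nonneg _
    have hv0 : 0 ≤ ‖v‖ := norm_nonneg _
    have hvd : |⟪v, d⟫| ≤ 1/2 * ‖x - z‖ := by
      refine (abs_real_inner_le_norm v d).trans ?_
      rw [e3]; nlinarith
    have t1 : (k x + k z - 2 * k m) * ‖v‖ ^ 2 ≤ M * ‖x - z‖ ^ 2 := by
      calc (k x + k z - 2 * k m) * ‖v‖ ^ 2 ≤ (M * ‖x - z‖ ^ 2) * ‖v‖ ^ 2 := by gcongr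
        _ ≤ (M * ‖x - z‖ ^ 2) * 1 := by gcongr; nlinarith
        _ = _ := by ring
    have t2 : 2 * ⟪v, d⟫ * (k x - k z) ≤ M * ‖x - z‖ ^ 2 := by
      calc 2 * ⟪v, d⟫ * (k x - k z) ≤ |2 * ⟪v, d⟫ * (k x - k z)| := le_abs_self _
        _ = 2 * |⟪v, d⟫| * |k x - k z| := by rw [abs_mul, abs_mul]; norm_num
        _ ≤ 2 * (1/2 * ‖x - z‖) * (M * ‖x - z‖) := by gcongr
        _ = _ := by ring
    have t3 : (k x + k z) * ‖d‖ ^ 2 ≤ M * ‖x - z‖ ^ 2 := by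
      rw [e3]
      calc (k x + k z) * (1/2 * ‖x - z‖) ^ 2 ≤ (M + M) * (1/2 * ‖x - z‖) ^ 2 := by
            gcongr
            · exact (le_abs_self _).trans a1
            · exact (le_abs_self _).trans b1
        _ ≤ _ := by nlinarith [mul_nonneg hM.le (sq_nonneg ‖x - z‖)]
    nlinarith

/-- The gradient of the variable inf-convolution. -/
theorem aux_infconv_grad {n : ℕ} (C : Set (Euc n)) (hC : IsClosed C) (W k V : Euc n → ℝ)
    (x y : Euc n) (hx : x ∉ C)
    (hV : V x = W y + k x * ‖x - y‖ ^ 2)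
    (hmin : ∀ z, z ∉ C → V z ≤ W y + k z * ‖z - y‖ ^ 2)
    (hk : DifferentiableAt ℝ k x) (hVd : DifferentiableAt ℝ V x) :
    ‖gradient V x - (2 * k x) • (x - y)‖ ≤ ‖x - y‖ ^ 2 * ‖fderiv ℝ k x‖ := by
  have hG : HasFDerivAt (fun z => W y + k z * ‖z - y‖ ^ 2)
      (k x • (2 • (innerSL ℝ (x - y))) + ‖x - y‖ ^ 2 • fderiv ℝ k x) x := by
    have h1 : HasFDerivAt (fun z => ‖z - y‖ ^ 2) (2 • (innerSL ℝ (x - y))) x := by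
      have := ((hasFDerivAt_id x).sub_const y).norm_sq
      simpa using this
    exact (hk.hasFDerivAt.mul h1).const_add (W y)
  have hmax : IsLocalMax (fun z => V z - (W y + k z * ‖z - y‖ ^ 2)) x := by
    filter_upwards [hC.isOpen_compl.mem_nhds hx] with z hz
    rw [hV]
    have := hmin z hz
    linarith
  have h0 := hmax.hasFDerivAt_eq_zero (hVd.hasFDerivAt.sub hG)
  rw [sub_eq_zero] at h0
  set w := gradient V x - (2 * k x) • (x - y) with hw
  have hgen : ∀ v, ⟪w, v⟫ = ‖x - y‖ ^ 2 * fderiv ℝ k x v := by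
    intro v
    have h1 : ⟪gradient V x, v⟫ = k x * (2 * ⟪x - y, v⟫) + ‖x - y‖ ^ 2 * fderiv ℝ k x v := by
      rw [inner_gradient_left, h0]
      simp only [add_apply, smul_apply, innerSL_apply_apply, smul_eq_mul, nsmul_eq_mul,
        Nat.cast_ofNat]
    rw [hw, inner_sub_left, h1, real_inner_smul_left]
    ring
  have hin := hgen w
  rw [real_inner_self_eq_norm_sq] at hin
  have hle : ‖w‖ ^ 2 ≤ ‖x - y‖ ^ 2 * (‖fderiv ℝ k x‖ * ‖w‖) := by
    rw [hin]
    gcongr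
    exact (le_abs_self _).trans ((fderiv ℝ k x).le_opNorm w)
  rcases (norm_nonneg w).eq_or_lt with h | h
  · rw [← h]; positivity
  · nlinarith

/-- Existence of minimizers in the variable inf-convolution, with estimates. -/
theorem aux_minimizer {n : ℕ} (C : Set (Euc n)) (W : Euc n → ℝ)
    (hWc : ContinuousOn W (closure Cᶜ)) (hWnn : ∀ x ∈ closure Cᶜ, 0 ≤ W x)
    (hWpd : PosDefOn C W) (hWpr : ProperOn C W) (x : Euc n) (hx : x ∉ C) (E ε : ℝ)
    (hE : 0 < E) (hE1 : E ≤ 1) (hL : ∀ y ∈ closure Cᶜ, W x - W y ≤ ‖x - y‖ / E) (hEW : E ≤ W x)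
    (hε : 0 < ε) (hεE : ε ≤ E ^ 4 / 4) :
    ∃ y, y ∉ C ∧ (∀ z ∈ closure Cᶜ, W y + ε⁻¹ * ‖x - y‖ ^ 2 ≤ W z + ε⁻¹ * ‖x - z‖ ^ 2) ∧
      ‖x - y‖ ≤ ε / E ∧ W x / 2 ≤ W y := by
  have hxc : x ∈ closure Cᶜ := subset_closure hx
  have hcomp := hWpr (Set.Icc 0 (W x)) isCompact_Icc (fun _ h => h.1)
  obtain ⟨y, ⟨hyc, hyW⟩, hymin⟩ := hcomp.exists_isMinOn ⟨x, hxc, hWnn x hxc, le_rfl⟩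
    (f := fun z => W z + ε⁻¹ * ‖x - z‖ ^ 2)
    ((hWc.mono Set.inter_subset_left).add (by fun_prop))
  have hmin : ∀ z ∈ closure Cᶜ, W y + ε⁻¹ * ‖x - y‖ ^ 2 ≤ W z + ε⁻¹ * ‖x - z‖ ^ 2 := by
    intro z hz
    by_cases hzx : W z ≤ W x
    · exact hymin ⟨hz, hWnn z hz, hzx⟩
    · have h1 : W y + ε⁻¹ * ‖x - y‖ ^ 2 ≤ W x + ε⁻¹ * ‖x - x‖ ^ 2 := hymin ⟨hxc, hWnn x hxc, le_rfl⟩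
      simp only [sub_self, norm_zero] at h1
      have : 0 ≤ ε⁻¹ * ‖x - z‖ ^ 2 := by positivity
      linarith
  have h1 := hmin x hxc
  simp only [sub_self, norm_zero] at h1
  have h2 := hL y hyc
  have hd : ‖x - y‖ ≤ ε / E := by
    rcases (norm_nonneg (x - y)).eq_or_lt with h | h
    · rw [← h]; positivity
    · have h3 : ε⁻¹ * ‖x - y‖ ^ 2 ≤ ‖x - y‖ / E := by linarith
      rw [inv_mul_le_iff₀ hε] at h3
      have : ‖x - y‖ * ‖x - y‖ ≤ (ε / E) * ‖x - y‖ := by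
        calc ‖x - y‖ * ‖x - y‖ = ‖x - y‖ ^ 2 := by ring
          _ ≤ _ := h3
          _ = _ := by ring
      exact le_of_mul_le_mul_right this h
  have hhalf : W x / 2 ≤ W y := by
    have : ‖x - y‖ / E ≤ E / 2 := by
      rw [div_le_iff₀ hE]
      refine hd.trans ?_
      rw [div_le_iff₀ hE]
      have : E ^ 4 ≤ E ^ 3 := pow_le_pow_of_le_one hE.le hE1 (by norm_num)
      nlinarith [pow_pos hE 3]
    linarith
  refine ⟨y, ?_, hmin, hd, hhalf⟩
  intro hyC
  have : y ∈ frontier C := by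
    rw [frontier_eq_closure_inter_closure]
    exact ⟨subset_closure hyC, hyc⟩
  have := hWpd.2 y this
  linarith

/-- Theorem 4.9: under (H1), a locally Lipschitz `p₀`-OMRF yields a genuine
(semiconcave) `(p₀/2)`-OMRF below it. -/
theorem lipschitz_omrf_implies_semiconcave_half_omrf
    {n m : ℕ} (C : Set (Euc n)) (U : Set (Euc m))
    (f : Euc n → Euc m → Euc n) (l : Euc n → Euc m → ℝ)
    (p0 : ℝ) (W : Euc n → ℝ)
    (hH1 : HypH1 C U f l) (hp0 : 0 ≤ p0)
    (hWc : ContinuousOn W (closure Cᶜ)) (hWnn : ∀ x ∈ closure Cᶜ, 0 ≤ W x)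
    (hWlip : LocLipschitzOn (closure Cᶜ) W)
    (hWpd : PosDefOn C W) (hWpr : ProperOn C W)
    (hdec : ∀ x, x ∉ C → ∀ p ∈ limitingSubdiff W x, Ham U f l p0 x p < 0) :
    ∃ Wb : Euc n → ℝ, IsOMRF C U f l (p0 / 2) Wb ∧ ∀ x, x ∉ C → Wb x ≤ W x := by
  classical
  have hC : IsClosed C := hH1.1
  have hO : IsOpen Cᶜ := hC.isOpen_compl
  -- the scale function `E`
  obtain ⟨E, hE, hEloc⟩ := aux_choose Cᶜ
    (fun x e => QProp U f l p0 W x e ∧ (∀ y ∈ closure Cᶜ, W x - W y ≤ ‖x - y‖ / e) ∧ e ≤ W x)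
    (by
      rintro x e e' he' hee ⟨h1, h2, h3⟩
      refine ⟨?_, ?_, hee.trans h3⟩
      · intro a y p q ha hy hq hp
        exact h1 a y p q (ha.trans hee) (hy.trans hee) hq (hp.trans hee)
      · intro y hy
        refine (h2 y hy).trans ?_
        gcongr)
    (by
      intro x0 hx0
      obtain ⟨e1, he1, r1, hr1, h1⟩ := aux_Q_local C U f l p0 W hH1 hWlip hdec x0 hx0
      obtain ⟨e2, he2, r2, hr2, h2⟩ := aux_lip_local C hC W hWc hWnn hWlip hWpd.1 x0 hx0
      refine ⟨min e1 e2, by positivity, min r1 r2, by positivity, fun x hx => ⟨?_, ?_, ?_⟩⟩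
      · intro a y p q ha hy hq hp
        exact h1 x (ball_subset_ball (min_le_left _ _) hx) a y p q (ha.trans (min_le_left _ _))
          (hy.trans (min_le_left _ _)) hq (hp.trans (min_le_left _ _))
      · intro y hy
        refine ((h2 x (ball_subset_ball (min_le_right _ _) hx)).1 y hy).trans ?_
        gcongr
        exact min_le_right _ _
      · exact (min_le_right _ _).trans (h2 x (ball_subset_ball (min_le_right _ _) hx)).2)
  obtain ⟨ε, hεd, hε⟩ := aux_eps Cᶜ hO (fun x => E x ^ 4 / 4) (by
    intro x0 hx0
    obtain ⟨e, he, r, hr, h⟩ := hEloc x0 hx0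
    refine ⟨e ^ 4 / 4, by positivity, r, hr, fun x hx => ?_⟩
    have := h x hx
    gcongr)
  have hYex : ∀ x, x ∉ C → ∃ y, y ∉ C ∧
      (∀ z ∈ closure Cᶜ, W y + (ε x)⁻¹ * ‖x - y‖ ^ 2 ≤ W z + (ε x)⁻¹ * ‖x - z‖ ^ 2) ∧
      ‖x - y‖ ≤ ε x / E x ∧ W x / 2 ≤ W y := fun x hx =>
    aux_minimizer C W hWc hWnn hWpd hWpr x hx (E x) (ε x) (hE x hx).1 (hE x hx).2.1
      (hE x hx).2.2.2.1 (hE x hx).2.2.2.2 (hε x hx).1 (hε x hx).2.1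
  choose! Y hYC hYmin hYd hYhalf using hYex
  let k : Euc n → ℝ := fun x => (ε x)⁻¹
  let V : Euc n → ℝ := fun x => if x ∈ C then 0 else W (Y x) + k x * ‖x - Y x‖ ^ 2
  have hV : ∀ x, x ∉ C → V x = W (Y x) + k x * ‖x - Y x‖ ^ 2 := fun x hx => if_neg hx
  have hV0 : ∀ x, x ∈ C → V x = 0 := fun x hx => if_pos hx
  have hkpos : ∀ x, x ∉ C → 0 < k x := fun x hx => inv_pos.2 (hε x hx).1
  have hmin : ∀ x, x ∉ C → ∀ z, z ∉ C → V x ≤ W z + k x * ‖x - z‖ ^ 2 := by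
    intro x hx z hz
    rw [hV x hx]
    exact hYmin x hx z (subset_closure hz)
  have hdE : ∀ x, x ∉ C → ‖x - Y x‖ ≤ E x / 4 := by
    intro x hx
    obtain ⟨h1, h2, -⟩ := hE x hx
    refine (hYd x hx).trans ?_
    rw [div_le_iff₀ h1]
    refine (hε x hx).2.1.trans ?_
    have : E x ^ 4 ≤ E x ^ 2 := pow_le_pow_of_le_one h1.le h2 (by norm_num)
    nlinarith
  have hd1 : ∀ x, x ∉ C → ‖x - Y x‖ ≤ 1 := by
    intro x hx
    have := hdE x hx
    have := (hE x hx).2.1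
    linarith
  have hk : ∀ x, x ∉ C → ContDiffAt ℝ 2 k x := fun x hx => hεd.contDiffAt.inv (hε x hx).1.ne'
  have hVle : ∀ x, x ∉ C → V x ≤ W x := by
    intro x hx
    have := hmin x hx x hx
    simpa using this
  have hVge : ∀ x, x ∉ C → W x / 2 ≤ V x := by
    intro x hx
    rw [hV x hx]
    have h1 := hYhalf x hx
    have h2 : 0 ≤ k x * ‖x - Y x‖ ^ 2 := mul_nonneg (hkpos x hx).le (by positivity)
    linarith
  have hfr : ∀ x ∈ closure Cᶜ, x ∈ C → W x = 0 := by
    intro x hx hxC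
    apply hWpd.2
    rw [frontier_eq_closure_inter_closure]
    exact ⟨subset_closure hxC, hx⟩
  have hVle' : ∀ x ∈ closure Cᶜ, V x ≤ W x := by
    intro x hx
    by_cases hxC : x ∈ C
    · rw [hV0 x hxC, hfr x hx hxC]
    · exact hVle x hxC
  have hVge' : ∀ x ∈ closure Cᶜ, W x / 2 ≤ V x := by
    intro x hx
    by_cases hxC : x ∈ C
    · rw [hV0 x hxC, hfr x hx hxC]; simp
    · exact hVge x hxC
  have hVnn : ∀ x ∈ closure Cᶜ, 0 ≤ V x := fun x hx => by
    have := hVge' x hx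
    have := hWnn x hx
    linarith
  have hloc := aux_infconv_local C hC W k Y V hYC hV hmin hd1 hk
  have hVc : ContinuousOn V (closure Cᶜ) := by
    intro x hx
    by_cases hxC : x ∈ C
    · have h1 : Tendsto W (𝓝[closure Cᶜ] x) (𝓝 0) := by
        have := hWc x hx
        rwa [ContinuousWithinAt, hfr x hx hxC] at this
      rw [ContinuousWithinAt, hV0 x hxC]
      refine tendsto_of_tendsto_of_tendsto_of_le_of_le' tendsto_const_nhds h1 ?_ ?_
      · filter_upwards [self_mem_nhdsWithin] with z hz using hVnn z hz
      · filter_upwards [self_mem_nhdsWithin] with z hz using hVle' z hz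
    · exact (hloc x hxC).1.continuousWithinAt
  refine ⟨V, ⟨hVc, hVnn, ?_, ⟨?_, ?_⟩, ?_, ?_⟩, hVle⟩
  · exact aux_local_global C V (hVc.mono subset_closure) (fun x hx => (hloc x hx).2)
  · intro x hx
    have := hVge x hx
    have := hWpd.1 x hx
    linarith
  · intro x hx
    exact hV0 x (hC.frontier_subset hx)
  · intro Kc hKc hKc0
    obtain ⟨b, hb⟩ := hKc.bddAbove
    have hcomp := hWpr (Set.Icc 0 (2 * b)) isCompact_Icc (fun _ h => h.1)
    refine hcomp.of_isClosed_subset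
      (hVc.preimage_isClosed_of_isClosed isClosed_closure hKc.isClosed) ?_
    rintro x ⟨hx, hxK⟩
    have h1 := hVge' x hx
    have h2 : V x ≤ b := hb hxK
    exact ⟨hx, hWnn x hx, by linarith⟩
  · intro x hx p hp
    obtain ⟨xk, hxk, hxt, hpt⟩ := hp
    obtain ⟨e, he, r, hr, hEe⟩ := hEloc x hx
    have ev1 := hxt.eventually (ball_mem_nhds x hr)
    have ev2 := hxt.eventually (hO.mem_nhds hx)
    have ev3 := hxt.eventually (closedBall_mem_nhds x he)
    have ev4 := hpt.eventually (closedBall_mem_nhds p (half_pos he))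
    obtain ⟨j, hj1, hj2, hj3, hj4⟩ := (ev1.and (ev2.and (ev3.and ev4))).exists
    set z := xk j with hz
    have hzC : z ∉ C := hj2
    have heE : e ≤ E z := hEe z hj1
    obtain ⟨hE0, hE1, hQ, -, -⟩ := hE z hzC
    obtain ⟨hε0, hε1, hε2⟩ := hε z hzC
    have hkd : fderiv ℝ k z = -((ε z) ^ 2)⁻¹ • fderiv ℝ ε z := by
      have : HasFDerivAt ε (fderiv ℝ ε z) z :=
        (hεd.differentiable (by norm_num) z).hasFDerivAt
      exact ((hasDerivAt_inv hε0.ne').comp_hasFDerivAt z this).fderiv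
    have hgrad := aux_infconv_grad C hC W k V z (Y z) hzC (hV z hzC)
      (fun w hw => hmin w hw (Y z) (hYC z hzC)) ((hk z hzC).differentiableAt (by norm_num)) (hxk j).1
    have hsmall : ‖z - Y z‖ ^ 2 * ‖fderiv ℝ k z‖ ≤ E z / 4 := by
      rw [hkd, norm_smul, norm_neg, Real.norm_of_nonneg (by positivity)]
      calc ‖z - Y z‖ ^ 2 * (((ε z) ^ 2)⁻¹ * ‖fderiv ℝ ε z‖)
          ≤ (ε z / E z) ^ 2 * (((ε z) ^ 2)⁻¹ * (E z ^ 4 / 4)) := by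
            gcongr
            exact hYd z hzC
        _ = E z ^ 2 / 4 := by field_simp
        _ ≤ E z / 4 := by nlinarith
    set q := (2 * k z) • (z - Y z) with hq
    have hqP : q ∈ proxSubdiff W (Y z) := by
      obtain ⟨η, hη, hball⟩ := Metric.nhds_basis_closedBall.mem_iff.1 (hO.mem_nhds (hYC z hzC))
      refine ⟨k z, hkpos z hzC, η, hη, fun w hw => ?_⟩
      have hwC : w ∉ C := hball (by rw [mem_closedBall, dist_eq_norm]; exact hw)
      have h1 := hYmin z hzC w (subset_closure hwC)
      have h2 : z - w = (z - Y z) - (w - Y z) := by abel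
      rw [h2, norm_sub_sq_real (z - Y z)] at h1
      rw [hq, inner_smul_left]
      simp only [conj_trivial]
      change W (Y z) + k z * _ ≤ W w + k z * _ at h1
      linarith
    have hpq : ‖p - q‖ ≤ E z := by
      have h1 : p - q = -(gradient V z - p) + (gradient V z - q) := by abel
      rw [dist_eq_norm] at hj4
      rw [h1]
      refine (norm_add_le _ _).trans ?_
      rw [norm_neg]
      linarith
    have hyz : ‖Y z - z‖ ≤ E z := by
      rw [norm_sub_rev]; linarith [hdE z hzC]
    have hxz : ‖x - z‖ ≤ E z := by
      rw [dist_eq_norm, norm_sub_rev] at hj3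
      exact hj3.trans heE
    obtain ⟨u, hu, hlt⟩ := hQ x (Y z) p q hxz hyz hqP hpq
    obtain ⟨-, -, -, hl0, -, -, hbd⟩ := hH1
    obtain ⟨Mf, Ml, Lf, Ll, -, -, -, -, hM, -⟩ := hbd {x} isCompact_singleton
      (Set.singleton_subset_iff.2 (subset_closure hx))
    refine csInf_lt_of_lt ⟨-(‖p‖ * Mf), ?_⟩ ⟨u, hu, rfl⟩ ?_
    · rintro _ ⟨v, hv, rfl⟩
      have h1 := (hM x rfl v hv).1
      have h2 := (abs_le.1 (abs_real_inner_le_norm p (f x v))).1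
      have h3 := mul_le_mul_of_nonneg_left h1 (norm_nonneg p)
      have h4 : 0 ≤ p0 / 2 * l x v := mul_nonneg (by positivity) (hl0 x v hv)
      change -(‖p‖ * Mf) ≤ ⟪p, f x v⟫ + p0 / 2 * l x v
      linarith
    · have h4 : 0 ≤ p0 / 2 * l x u := mul_nonneg (by positivity) (hl0 x u hu)
      change ⟪p, f x u⟫ + p0 / 2 * l x u < 0
      linarith
end
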